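/- Let 0 < α < 5/12 and s > 0. Then there exists a constant C > 0, depending only on s and α, such that for all signs σ, σ₁, σ₂, σ₃ ∈ {−1, 1}, all dyadic numbers N₁, N₂, N₃, and every m ∈ ℤ: ∑_{n₁,n₂,n₃ ∈ ℤ²} ⟨n₁+n₂+n₃⟩^{2(s−1)} · ∏_{j=1}^{3} [ 1_{|n_j| ∼ N_j} · ⟨n_j⟩^{−2+2α} ] · 1_{|φ(n₁,n₂,n₃) − m| ≤ 1} ≤ C · max(N₁, N₂, N₃)^{2(s − s_α)}. -/

import Mathlib

/-- The Euclidean norm of a lattice point `x ∈ ℤ²`. -/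
noncomputable def znorm (x : Fin 2 → ℤ) : ℝ :=
  Real.sqrt ((x 0 : ℝ) ^ 2 + (x 1 : ℝ) ^ 2)

/-- The Japanese bracket `⟨x⟩ = √(1 + |x|²)` for lattice points `x ∈ ℤ²`. -/
noncomputable def jb (x : Fin 2 → ℤ) : ℝ :=
  Real.sqrt (1 + (x 0 : ℝ) ^ 2 + (x 1 : ℝ) ^ 2)

/-- `|x| ∼ N`, i.e. `N/2 ≤ |x| ≤ 2N`. -/
def ann (N : ℝ) (x : Fin 2 → ℤ) : Prop :=
  N / 2 ≤ znorm x ∧ znorm x ≤ 2 * N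

/-- The cubic phase function `φ(n₁,n₂,n₃) = σ⟨n₁+n₂+n₃⟩ + σ₁⟨n₁⟩ + σ₂⟨n₂⟩ + σ₃⟨n₃⟩`. -/
noncomputable def phase (σ σ₁ σ₂ σ₃ : ℝ) (n₁ n₂ n₃ : Fin 2 → ℤ) : ℝ :=
  σ * jb (n₁ + n₂ + n₃) + σ₁ * jb n₁ + σ₂ * jb n₂ + σ₃ * jb n₃

/-- The median (middle value) of three real numbers. -/
noncomputable def med3 (a b c : ℝ) : ℝ :=
  max (min a b) (min (max a b) c)

-- `s_α = 1 − 2α` for `0 < α < 1/4` and `s_α = 5/4 − 3α` for `1/4 ≤ α < 5/12`.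
open Classical in
noncomputable def sAlpha (α : ℝ) : ℝ :=
  if α < 1 / 4 then 1 - 2 * α else 5 / 4 - 3 * α

theorem Int.card_le_of_diam_le (S : Finset ℤ) {L : ℝ} (hL : 0 ≤ L)
    (h : ∀ t ∈ S, ∀ t' ∈ S, (t' : ℝ) - t ≤ L) : (S.card : ℝ) ≤ L + 1 := by
  rcases S.eq_empty_or_nonempty with rfl | hS
  · simp; linarith
  have hsub : S ⊆ Finset.Icc (S.min' hS) (S.max' hS) := fun x hx =>
    Finset.mem_Icc.2 ⟨S.min'_le x hx, S.le_max' x hx⟩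
  have hle := S.min'_le _ (S.max'_mem hS)
  have hd := h _ (S.min'_mem hS) _ (S.max'_mem hS)
  have hc := Finset.card_le_card hsub
  rw [Int.card_Icc] at hc
  have hc' : (S.card : ℤ) ≤ S.max' hS + 1 - S.min' hS := by omega
  have hc'' : (S.card : ℝ) ≤ S.max' hS + 1 - S.min' hS := by exact_mod_cast hc'
  linarith

theorem Int.card_le_of_no_three_separated (S : Finset ℤ) {L : ℝ} (hL : 0 ≤ L)
    (h : ∀ t₁ ∈ S, ∀ t₂ ∈ S, ∀ t₃ ∈ S, L < (t₂ : ℝ) - t₁ → (t₃ : ℝ) - t₂ ≤ L) :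
    (S.card : ℝ) ≤ 2 * (L + 1) := by
  rcases S.eq_empty_or_nonempty with rfl | hS
  · simp; linarith
  have h1 := Int.card_le_of_diam_le (S.filter fun t : ℤ => (t : ℝ) - S.min' hS ≤ L) hL
    (fun t ht t' ht' => by
      rw [Finset.mem_filter] at ht ht'
      have : (S.min' hS : ℝ) ≤ t := by exact_mod_cast S.min'_le t ht.1
      linarith [ht'.2])
  have h2 := Int.card_le_of_diam_le (S.filter fun t : ℤ => ¬ (t : ℝ) - S.min' hS ≤ L) hL
    (fun t ht t' ht' => by
      rw [Finset.mem_filter] at ht ht'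
      exact h _ (S.min'_mem hS) t ht.1 t' ht'.1 (not_le.1 ht.2))
  have h3 : ((S.filter fun t : ℤ => (t : ℝ) - S.min' hS ≤ L).card : ℝ) +
      ((S.filter fun t : ℤ => ¬ (t : ℝ) - S.min' hS ≤ L).card : ℝ) = S.card := by
    exact_mod_cast Finset.card_filter_add_card_filter_not _
  linarith

/-- Strong convexity of `t ↦ √(A + t²)` on `{t | √(A + t²) ≤ R}`. -/
theorem sqrt_add_sq_strongly_convex {A R t u : ℝ} (hA : 0 < A)
    (ht : √(A + t ^ 2) ≤ R) (hu : √(A + u ^ 2) ≤ R) :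
    √(A + u ^ 2) + u / √(A + u ^ 2) * (t - u) + A / (2 * R ^ 3) * (t - u) ^ 2 ≤
      √(A + t ^ 2) := by
  set g := √(A + t ^ 2)
  set k := √(A + u ^ 2)
  have hg : 0 < g := Real.sqrt_pos.2 (by positivity)
  have hk : 0 < k := Real.sqrt_pos.2 (by positivity)
  have hg2 : g ^ 2 = A + t ^ 2 := Real.sq_sqrt (by positivity)
  have hk2 : k ^ 2 = A + u ^ 2 := Real.sq_sqrt (by positivity)
  have hR : 0 < R := hk.trans_le hu
  have hprod : (g * k) ^ 2 - (A + t * u) ^ 2 = A * (t - u) ^ 2 := by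
    rw [mul_pow, hg2, hk2]; ring
  have hle : A + t * u ≤ g * k := by
    apply le_of_sq_le_sq _ (by positivity)
    nlinarith [mul_nonneg hA.le (sq_nonneg (t - u))]
  have hgap : A * (t - u) ^ 2 ≤ (g * k - (A + t * u)) * (2 * (g * k)) := by
    rw [← hprod]; nlinarith
  have hgk : g * k ≤ R * R := mul_le_mul ht hu hk.le hR.le
  have h3 : A * (t - u) ^ 2 ≤ (g * k - (A + t * u)) * (2 * R ^ 2) := by
    refine hgap.trans (mul_le_mul_of_nonneg_left (by nlinarith) (by linarith))
  have h4 : A / (2 * R ^ 3) * (t - u) ^ 2 ≤ (g * k - (A + t * u)) / R := by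
    rw [div_mul_eq_mul_div, div_le_div_iff₀ (by positivity) hR]
    calc A * (t - u) ^ 2 * R ≤ (g * k - (A + t * u)) * (2 * R ^ 2) * R := by gcongr
      _ = _ := by ring
  have h5 : (g * k - (A + t * u)) / R ≤ (g * k - (A + t * u)) / k :=
    div_le_div_of_nonneg_left (by linarith) hk hu
  have h6 : (g * k - (A + t * u)) / k = g - k - u / k * (t - u) := by
    field_simp
    nlinarith
  linarith

theorem card_le_of_curved {A R q c K D L : ℝ} (S : Finset ℤ) (hA : 0 < A) (hR : 0 < R)
    (hL : 0 ≤ L)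
    (hSR : ∀ t ∈ S, √(A + (t : ℝ) ^ 2) ≤ R)
    (hS : ∀ t ∈ S, |q * t - c * √(A + (t : ℝ) ^ 2) - K| ≤ D)
    (hlt : 4 * D * R ^ 3 < |c| * A * L ^ 2) : (S.card : ℝ) ≤ 2 * (L + 1) := by
  refine Int.card_le_of_no_three_separated S hL fun t₁ h₁ t₂ h₂ t₃ h₃ h12 => ?_
  by_contra! h23
  have c1 := sqrt_add_sq_strongly_convex hA (hSR t₁ h₁) (hSR t₂ h₂)
  have c3 := sqrt_add_sq_strongly_convex hA (hSR t₃ h₃) (hSR t₂ h₂)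
  have d1 := abs_le.1 (hS t₁ h₁)
  have d2 := abs_le.1 (hS t₂ h₂)
  have d3 := abs_le.1 (hS t₃ h₃)
  set g₁ := √(A + (t₁ : ℝ) ^ 2)
  set g₂ := √(A + (t₂ : ℝ) ^ 2)
  set g₃ := √(A + (t₃ : ℝ) ^ 2)
  set κ := A / (2 * R ^ 3) with hκ
  have hκ0 : 0 < κ := by positivity
  obtain ⟨a, ha⟩ : ∃ a, a = (t₂ : ℝ) - t₁ := ⟨_, rfl⟩
  obtain ⟨b, hb⟩ : ∃ b, b = (t₃ : ℝ) - t₂ := ⟨_, rfl⟩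
  rw [← ha] at h12
  rw [← hb] at h23
  have ha0 : 0 < a := by linarith
  have hb0 : 0 < b := by linarith
  have e1 : (t₁ : ℝ) - t₂ = -a := by linarith
  rw [e1] at c1
  rw [← hb] at c3
  have conv : κ * (a * b) * (a + b) ≤ b * g₁ + a * g₃ - (a + b) * g₂ := by
    nlinarith [mul_le_mul_of_nonneg_left c1 hb0.le, mul_le_mul_of_nonneg_left c3 ha0.le]
  have key : |c| * (b * g₁ + a * g₃ - (a + b) * g₂) ≤ 2 * D * (a + b) := by
    have hid : b * (q * t₁ - c * g₁ - K) + a * (q * t₃ - c * g₃ - K)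
        - (a + b) * (q * t₂ - c * g₂ - K) = - c * (b * g₁ + a * g₃ - (a + b) * g₂) := by
      have : (t₁ : ℝ) = t₂ - a := by linarith
      have h' : (t₃ : ℝ) = t₂ + b := by linarith
      rw [this, h']; ring
    have m1 := mul_le_mul_of_nonneg_left d1.1 hb0.le
    have m1' := mul_le_mul_of_nonneg_left d1.2 hb0.le
    have m3 := mul_le_mul_of_nonneg_left d3.1 ha0.le
    have m3' := mul_le_mul_of_nonneg_left d3.2 ha0.le
    have m2 := mul_le_mul_of_nonneg_left d2.1 (add_pos ha0 hb0).le
    have m2' := mul_le_mul_of_nonneg_left d2.2 (add_pos ha0 hb0).le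
    rcases abs_cases c with ⟨hc, _⟩ | ⟨hc, _⟩ <;> rw [hc] <;> nlinarith
  have h1 : |c| * (κ * (a * b)) * (a + b) ≤ 2 * D * (a + b) := by
    calc |c| * (κ * (a * b)) * (a + b) = |c| * (κ * (a * b) * (a + b)) := by ring
      _ ≤ _ := (mul_le_mul_of_nonneg_left conv (abs_nonneg c)).trans key
  have h2 : |c| * (κ * (a * b)) ≤ 2 * D := le_of_mul_le_mul_right h1 (by linarith)
  have h3 : |c| * (κ * L ^ 2) ≤ 2 * D := by
    refine le_trans ?_ h2
    have : L ^ 2 ≤ a * b := by nlinarith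
    gcongr
  have h4 : |c| * A * L ^ 2 = |c| * (κ * L ^ 2) * (2 * R ^ 3) := by
    rw [hκ]; field_simp
  have h5 : |c| * (κ * L ^ 2) * (2 * R ^ 3) ≤ 2 * D * (2 * R ^ 3) := by gcongr
  linarith

theorem card_le_of_transversal {A q c K D δ : ℝ} (S : Finset ℤ) (hA : 0 < A) (hD : 0 ≤ D)
    (hδ : 0 < δ) (hq : |c| + δ ≤ |q|)
    (hS : ∀ t ∈ S, |q * t - c * √(A + (t : ℝ) ^ 2) - K| ≤ D) :
    (S.card : ℝ) ≤ 2 * D / δ + 1 := by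
  refine Int.card_le_of_diam_le S (by positivity) fun t ht u hu => ?_
  by_cases htu : (u : ℝ) ≤ t
  · exact (sub_nonpos.2 htu).trans (by positivity)
  push Not at htu
  have hlip : |√(A + (u : ℝ) ^ 2) - √(A + (t : ℝ) ^ 2)| ≤ u - t := by
    have h1 := Real.sqrt_nonneg (A + (u : ℝ) ^ 2)
    have h2 := Real.sqrt_nonneg (A + (t : ℝ) ^ 2)
    have h3 : √(A + (u : ℝ) ^ 2) ^ 2 = A + (u : ℝ) ^ 2 := Real.sq_sqrt (by positivity)
    have h4 : √(A + (t : ℝ) ^ 2) ^ 2 = A + (t : ℝ) ^ 2 := Real.sq_sqrt (by positivity)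
    have h5 : |(u : ℝ)| ≤ √(A + (u : ℝ) ^ 2) := Real.abs_le_sqrt (by linarith)
    have h6 : |(t : ℝ)| ≤ √(A + (t : ℝ) ^ 2) := Real.abs_le_sqrt (by linarith)
    have h7 := abs_le.1 h5
    have h8 := abs_le.1 h6
    have h9 : 0 < √(A + (u : ℝ) ^ 2) := Real.sqrt_pos.2 (by positivity)
    rw [abs_le]
    constructor <;> nlinarith
  have d1 := abs_le.1 (hS t ht)
  have d2 := abs_le.1 (hS u hu)
  set g := √(A + (u : ℝ) ^ 2) - √(A + (t : ℝ) ^ 2) with hg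
  have hb : |q * (u - t) - c * g| ≤ 2 * D := by
    rw [abs_le, hg]; constructor <;> nlinarith
  have h1 : |q * (u - t)| ≤ |q * (u - t) - c * g| + |c * g| := by
    simpa using abs_add_le (q * (u - t) - c * g) (c * g)
  rw [abs_mul, abs_mul c, abs_of_pos (sub_pos.2 htu)] at h1
  have h2 : |c| * |g| ≤ |c| * (u - t) := by gcongr
  rw [le_div_iff₀ hδ]
  nlinarith [mul_le_mul_of_nonneg_right hq (sub_pos.2 htu).le]

theorem card_le_of_lines {N M : ℝ} (hN : 1 ≤ N) (hM : 0 ≤ M) {i j : Fin 2} (hij : i ≠ j)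
    (E : Finset (Fin 2 → ℤ)) (hE : ∀ x ∈ E, |(x i : ℝ)| ≤ 2 * N)
    (h : ∀ (u : ℤ) (S : Finset ℤ), (∀ t ∈ S, ∃ x ∈ E, x i = u ∧ x j = t) →
      (S.card : ℝ) ≤ M) : (E.card : ℝ) ≤ 5 * N * M := by
  have himg : ((E.image fun x => x i).card : ℝ) ≤ 4 * N + 1 := by
    refine Int.card_le_of_diam_le _ (by linarith) fun t ht u hu => ?_
    obtain ⟨x, hx, rfl⟩ := Finset.mem_image.1 ht
    obtain ⟨y, hy, rfl⟩ := Finset.mem_image.1 hu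
    linarith [(abs_le.1 (hE x hx)).1, (abs_le.1 (hE y hy)).2]
  rw [Finset.card_eq_sum_card_image (fun x => x i) E]
  push_cast
  calc (∑ u ∈ E.image fun x => x i, ((E.filter fun x => x i = u).card : ℝ))
      ≤ ∑ u ∈ E.image fun x => x i, M := by
        refine Finset.sum_le_sum fun u _ => ?_
        have hinj : Set.InjOn (fun x : Fin 2 → ℤ => x j) (E.filter fun x => x i = u) := by
          intro x hx y hy hxy
          simp only [Finset.coe_filter, Set.mem_ofPred_eq] at hx hy
          funext l
          have hl : l = i ∨ l = j := by omega
          rcases hl with rfl | rfl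
          · rw [hx.2, hy.2]
          · exact hxy
        rw [← Finset.card_image_of_injOn hinj]
        refine h u _ fun t ht => ?_
        obtain ⟨x, hx, rfl⟩ := Finset.mem_image.1 ht
        rw [Finset.mem_filter] at hx
        exact ⟨x, hx.1, hx.2, rfl⟩
    _ = ((E.image fun x => x i).card : ℝ) * M := by simp
    _ ≤ 5 * N * M := by gcongr; linarith

theorem jb_eq_sqrt {i j : Fin 2} (hij : i ≠ j) (x : Fin 2 → ℤ) :
    jb x = √((1 + (x i : ℝ) ^ 2) + (x j : ℝ) ^ 2) := by
  unfold jb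
  fin_cases i <;> fin_cases j <;> simp_all
  congr 1; ring

theorem znorm_sq_eq {i j : Fin 2} (hij : i ≠ j) (x : Fin 2 → ℤ) :
    znorm x ^ 2 = (x i : ℝ) ^ 2 + (x j : ℝ) ^ 2 := by
  unfold znorm
  rw [Real.sq_sqrt (by positivity)]
  fin_cases i <;> fin_cases j <;> simp_all
  ring

theorem jb_sq (x : Fin 2 → ℤ) : jb x ^ 2 = 1 + znorm x ^ 2 := by
  unfold jb znorm
  rw [Real.sq_sqrt (by positivity), Real.sq_sqrt (by positivity)]; ring

theorem one_le_jb (x : Fin 2 → ℤ) : 1 ≤ jb x := by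
  unfold jb
  rw [Real.one_le_sqrt]
  nlinarith [sq_nonneg (x 0 : ℝ), sq_nonneg (x 1 : ℝ)]

theorem znorm_nonneg (x : Fin 2 → ℤ) : 0 ≤ znorm x := Real.sqrt_nonneg _

theorem znorm_le_jb (x : Fin 2 → ℤ) : znorm x ≤ jb x := by
  have := one_le_jb x
  exact le_of_sq_le_sq (by linarith [jb_sq x]) (by linarith)

theorem jb_le_znorm_add_one (x : Fin 2 → ℤ) : jb x ≤ znorm x + 1 := by
  have := znorm_nonneg x
  exact le_of_sq_le_sq (by nlinarith [jb_sq x]) (by linarith)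

theorem znorm_add_le (x y : Fin 2 → ℤ) : znorm (x + y) ≤ znorm x + znorm y := by
  have h (z : Fin 2 → ℤ) : znorm z = ‖(!₂[(z 0 : ℝ), (z 1 : ℝ)] : EuclideanSpace ℝ (Fin 2))‖ := by
    simp [znorm, EuclideanSpace.norm_eq]
  rw [h, h, h]
  refine le_trans (le_of_eq ?_) (norm_add_le _ _)
  congr 1
  ext l; fin_cases l <;> simp

theorem znorm_neg (x : Fin 2 → ℤ) : znorm (-x) = znorm x := by simp [znorm]

theorem abs_coord_le_znorm (x : Fin 2 → ℤ) (i : Fin 2) : |(x i : ℝ)| ≤ znorm x := by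
  unfold znorm
  apply Real.abs_le_sqrt
  fin_cases i <;> simp <;> positivity

/-- Lattice points near a curved level set, in the sector where the curvature is seen along the
lines `x i = const`. -/
theorem card_le_of_curved_sector {N P c K : ℝ} (hN : 1 ≤ N) (hP : 1 ≤ P) (hc : P / 2 ≤ |c|)
    (p : Fin 2 → ℤ) {i j : Fin 2} (hij : i ≠ j) (E : Finset (Fin 2 → ℤ))
    (hE : ∀ x ∈ E, ann N x)
    (hK : ∀ x ∈ E, |(p i * x i + p j * x j) - c * jb x - K| ≤ 10 * (N + P))
    (hs : ∀ x ∈ E, |(x j : ℝ)| ≤ |(x i : ℝ)|) :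
    (E.card : ℝ) ≤ 2010 * (N ^ 2 / √P + N * √N) := by
  have hsP : 0 < √P := Real.sqrt_pos.2 (by linarith)
  have hsN : 1 ≤ √N := Real.one_le_sqrt.2 hN
  have hsP2 : √P ^ 2 = P := Real.sq_sqrt (by linarith)
  have hsN2 : √N ^ 2 = N := Real.sq_sqrt (by linarith)
  set L := 200 * (N / √P + √N) with hL
  have hNP : 0 < N / √P := by positivity
  have hL0 : 0 ≤ L := by positivity
  have hL2 : 40000 * (N ^ 2 / P + N) ≤ L ^ 2 := by
    have : (N / √P) ^ 2 = N ^ 2 / P := by rw [div_pow, hsP2]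
    rw [hL, ← this]; nlinarith
  have hL3 : 40000 * (N * (N + P)) ≤ P * L ^ 2 := by
    have : 40000 * (N * (N + P)) = P * (40000 * (N ^ 2 / P + N)) := by field_simp
    rw [this]; gcongr
  have main : (E.card : ℝ) ≤ 5 * N * (2 * (L + 1)) := by
    refine card_le_of_lines hN (by positivity) hij E
      (fun x hx => (abs_coord_le_znorm x i).trans (hE x hx).2) fun u S hS => ?_
    rcases S.eq_empty_or_nonempty with rfl | ⟨t₀, ht₀⟩
    · simp; positivity
    have hu : N ^ 2 / 8 ≤ 1 + (u : ℝ) ^ 2 := by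
      obtain ⟨x, hx, rfl, rfl⟩ := hS t₀ ht₀
      have h1 := sq_le_sq.2 (hs x hx)
      have h2 := znorm_sq_eq hij x
      have h3 : (N / 2) ^ 2 ≤ znorm x ^ 2 := by
        have := (hE x hx).1
        gcongr
      nlinarith
    refine card_le_of_curved (A := 1 + (u : ℝ) ^ 2) (R := 3 * N) (q := p j) (c := c)
      (K := K - p i * u) (D := 10 * (N + P)) S (by positivity) (by positivity) hL0 ?_ ?_ ?_
    · intro t ht
      obtain ⟨x, hx, rfl, rfl⟩ := hS t ht
      rw [← jb_eq_sqrt hij]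
      linarith [jb_le_znorm_add_one x, (hE x hx).2]
    · intro t ht
      obtain ⟨x, hx, rfl, rfl⟩ := hS t ht
      rw [← jb_eq_sqrt hij]
      refine le_trans (le_of_eq ?_) (hK x hx)
      congr 1; ring
    · have h1 : P / 2 * (N ^ 2 / 8) * L ^ 2 ≤ |c| * (1 + (u : ℝ) ^ 2) * L ^ 2 := by gcongr
      refine lt_of_lt_of_le ?_ h1
      have h2 : N ^ 2 * (40000 * (N * (N + P))) ≤ N ^ 2 * (P * L ^ 2) := by gcongr
      have h3 : 0 < N ^ 2 * (N * (N + P)) := by positivity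
      nlinarith
  refine main.trans ?_
  have h1 : N * (N / √P) = N ^ 2 / √P := by ring
  have h2 : L + 1 ≤ 201 * (N / √P + √N) := by rw [hL]; linarith
  calc 5 * N * (2 * (L + 1)) ≤ 5 * N * (2 * (201 * (N / √P + √N))) := by gcongr
    _ = 2010 * (N * (N / √P) + N * √N) := by ring
    _ = _ := by rw [h1]

/-- Lattice points near a level set which is transversal to the lines `x i = const`. -/
theorem card_le_of_transversal_lines {N P c K : ℝ} (hN : 1 ≤ N) (hP : 1 ≤ P) (hc : |c| ≤ P / 2)
    (p : Fin 2 → ℤ) {i j : Fin 2} (hij : i ≠ j) (hp : 7 / 10 * P ≤ |(p j : ℝ)|)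
    (E : Finset (Fin 2 → ℤ))
    (hE : ∀ x ∈ E, ann N x)
    (hK : ∀ x ∈ E, |(p i * x i + p j * x j) - c * jb x - K| ≤ 10 * (N + P)) :
    (E.card : ℝ) ≤ 2010 * (N ^ 2 / √P + N * √N) := by
  have hsP : 1 ≤ √P := Real.one_le_sqrt.2 hP
  have hsN : 1 ≤ √N := Real.one_le_sqrt.2 hN
  have hsP2 : √P ^ 2 = P := Real.sq_sqrt (by linarith)
  have main : (E.card : ℝ) ≤ 5 * N * (2 * (10 * (N + P)) / (P / 5) + 1) := by
    refine card_le_of_lines hN (by positivity) hij E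
      (fun x hx => (abs_coord_le_znorm x i).trans (hE x hx).2) fun u S hS => ?_
    refine card_le_of_transversal (A := 1 + (u : ℝ) ^ 2) (q := p j) (c := c)
      (K := K - p i * u) S (by positivity) (by positivity) (by positivity) (by linarith) ?_
    intro t ht
    obtain ⟨x, hx, rfl, rfl⟩ := hS t ht
    rw [← jb_eq_sqrt hij]
    refine le_trans (le_of_eq ?_) (hK x hx)
    congr 1; ring
  refine main.trans ?_
  have h1 : N / P ≤ N / √P :=
    div_le_div_of_nonneg_left (by linarith) (by linarith) (by nlinarith)
  have h0 : 0 < N / √P := by positivity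
  have h2 : 2 * (10 * (N + P)) / (P / 5) + 1 = 100 * (N / P) + 101 := by field_simp; ring
  have h3 : N * (N / √P) = N ^ 2 / √P := by ring
  rw [h2]
  calc 5 * N * (100 * (N / P) + 101) ≤ 5 * N * (402 * (N / √P + √N)) := by
        gcongr; linarith
    _ = 2010 * (N * (N / √P) + N * √N) := by ring
    _ = _ := by rw [h3]

theorem card_near_level_set_le {N P c K : ℝ} (hN : 1 ≤ N) (hP : 1 ≤ P)
    (p : Fin 2 → ℤ) (hp : znorm p = P) (E : Finset (Fin 2 → ℤ)) (hE : ∀ x ∈ E, ann N x)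
    (hK : ∀ x ∈ E, |(p 0 * x 0 + p 1 * x 1) - c * jb x - K| ≤ 10 * (N + P)) :
    (E.card : ℝ) ≤ 4020 * (N ^ 2 / √P + N * √N) := by
  have hK' : ∀ x ∈ E, |(p 1 * x 1 + p 0 * x 0) - c * jb x - K| ≤ 10 * (N + P) := by
    intro x hx; rw [add_comm (p 1 * x 1 : ℝ)]; exact hK x hx
  have hpos : 0 ≤ N ^ 2 / √P + N * √N := by positivity
  have h01 : (0 : Fin 2) ≠ 1 := by decide
  rcases le_total (P / 2) |c| with hc | hc
  · have e1 := card_le_of_curved_sector hN hP hc p h01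
      (E.filter fun x => |(x 1 : ℝ)| ≤ |(x 0 : ℝ)|)
      (fun x hx => hE x (Finset.mem_filter.1 hx).1)
      (fun x hx => hK x (Finset.mem_filter.1 hx).1) (fun x hx => (Finset.mem_filter.1 hx).2)
    have e2 := card_le_of_curved_sector hN hP hc p h01.symm
      (E.filter fun x => ¬ |(x 1 : ℝ)| ≤ |(x 0 : ℝ)|)
      (fun x hx => hE x (Finset.mem_filter.1 hx).1)
      (fun x hx => hK' x (Finset.mem_filter.1 hx).1)
      (fun x hx => (not_le.1 (Finset.mem_filter.1 hx).2).le)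
    have e3 : ((E.filter fun x => |(x 1 : ℝ)| ≤ |(x 0 : ℝ)|).card : ℝ) +
        ((E.filter fun x => ¬ |(x 1 : ℝ)| ≤ |(x 0 : ℝ)|).card : ℝ) = E.card := by
      exact_mod_cast Finset.card_filter_add_card_filter_not _
    linarith
  · have hsq := znorm_sq_eq h01 p
    rw [hp] at hsq
    rcases le_total |(p 0 : ℝ)| |(p 1 : ℝ)| with h | h
    · have := card_le_of_transversal_lines hN hP hc p h01
        (by have := sq_le_sq.2 h
            rw [← abs_of_nonneg (by positivity : 0 ≤ 7 / 10 * P)]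
            apply sq_le_sq.1; nlinarith) E hE hK
      linarith
    · have := card_le_of_transversal_lines hN hP hc p h01.symm
        (by have := sq_le_sq.2 h
            rw [← abs_of_nonneg (by positivity : 0 ≤ 7 / 10 * P)]
            apply sq_le_sq.1; nlinarith) E hE hK'
      linarith

theorem one_le_znorm {p : Fin 2 → ℤ} (hp : p ≠ 0) : 1 ≤ znorm p := by
  unfold znorm
  rw [Real.one_le_sqrt]
  have : ∃ i, p i ≠ 0 := by
    by_contra! h
    exact hp (funext h)
  obtain ⟨i, hi⟩ := this
  have h0 : 0 < p i ^ 2 := by positivity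
  have h1 : (1 : ℤ) ≤ p i ^ 2 := h0
  have h2 : (1 : ℤ) ≤ p 0 ^ 2 + p 1 ^ 2 := by
    rcases (by omega : i = 0 ∨ i = 1) with rfl | rfl
    · linarith [sq_nonneg (p 1)]
    · linarith [sq_nonneg (p 0)]
  exact_mod_cast h2

theorem card_le_of_znorm_le {N : ℝ} (hN : 1 ≤ N) (E : Finset (Fin 2 → ℤ))
    (hE : ∀ x ∈ E, znorm x ≤ 2 * N) : (E.card : ℝ) ≤ 25 * N ^ 2 := by
  have : (E.card : ℝ) ≤ 5 * N * (5 * N) := by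
    refine card_le_of_lines (i := 0) (j := 1) hN (by positivity) (by decide) E
      (fun x hx => (abs_coord_le_znorm x 0).trans (hE x hx)) fun u S hS => ?_
    refine (Int.card_le_of_diam_le S (L := 4 * N) (by positivity) ?_).trans (by linarith)
    intro t ht t' ht'
    obtain ⟨x, hx, rfl, rfl⟩ := hS t ht
    obtain ⟨y, hy, _, rfl⟩ := hS t' ht'
    have h1 := abs_le.1 ((abs_coord_le_znorm x 1).trans (hE x hx))
    have h2 := abs_le.1 ((abs_coord_le_znorm y 1).trans (hE y hy))
    linarith
  linarith

/-- The basic counting estimate: lattice points of size `N` for which the two-wave phase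
`±⟨x⟩ ± ⟨p - x⟩` lies in a given unit interval. -/
theorem card_two_wave_le {N σ τ c : ℝ} (hN : 1 ≤ N) (hσ : σ = -1 ∨ σ = 1)
    (hτ : τ = -1 ∨ τ = 1) (p : Fin 2 → ℤ) (E : Finset (Fin 2 → ℤ)) (hE : ∀ x ∈ E, ann N x)
    (h : ∀ x ∈ E, |σ * jb x + τ * jb (p - x) - c| ≤ 1) :
    (E.card : ℝ) ≤ 8040 * N ^ 2 * (jb p ^ (-1 / 2 : ℝ) + N ^ (-1 / 2 : ℝ)) := by
  have hN0 : 0 < N := by linarith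
  have half (x : ℝ) (hx : 0 < x) : x ^ (-1 / 2 : ℝ) = 1 / √x := by
    rw [neg_div, Real.rpow_neg hx.le, Real.sqrt_eq_rpow, one_div (x ^ _)]
  have hjp := one_le_jb p
  rw [half _ (by linarith), half _ hN0]
  have h01 : (0 : Fin 2) ≠ 1 := by decide
  rcases eq_or_ne p 0 with rfl | hp
  · have hj : jb 0 = 1 := by simp [jb]
    rw [hj]
    have := card_le_of_znorm_le hN E fun x hx => (hE x hx).2
    have h3 : 0 ≤ N ^ 2 * (1 / √N) := by positivity
    simp
    simp at h3
    nlinarith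
  have hP := one_le_znorm hp
  have key : ∀ x ∈ E, |(p 0 * x 0 + p 1 * x 1) - (σ * c) * jb x - (znorm p ^ 2 - c ^ 2) / 2| ≤
      10 * (N + znorm p) := by
    intro x hx
    have hxc := h x hx
    obtain ⟨f, hf⟩ : ∃ f, f = σ * jb x + τ * jb (p - x) := ⟨_, rfl⟩
    rw [← hf] at hxc
    have hσ2 : σ ^ 2 = 1 := by rcases hσ with rfl | rfl <;> norm_num
    have hτ2 : τ ^ 2 = 1 := by rcases hτ with rfl | rfl <;> norm_num
    have hx1 := one_le_jb x
    have hx2 := one_le_jb (p - x)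
    have hxN := (hE x hx).2
    have hx3 := jb_le_znorm_add_one x
    have hx4 := jb_le_znorm_add_one (p - x)
    have hx5 := znorm_add_le p (-x)
    rw [znorm_neg, ← sub_eq_add_neg] at hx5
    have hfb : |f| ≤ jb x + jb (p - x) := by
      rw [hf]
      rcases hσ with rfl | rfl <;> rcases hτ with rfl | rfl <;> rw [abs_le] <;>
        constructor <;> linarith
    have e1 : jb (p - x) ^ 2 = (f - σ * jb x) ^ 2 := by
      have : f - σ * jb x = τ * jb (p - x) := by rw [hf]; ring
      rw [this, mul_pow, hτ2, one_mul]
    have e2 := jb_sq (p - x)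
    have e3 := jb_sq x
    rw [znorm_sq_eq h01] at e2 e3 ⊢
    simp only [Pi.sub_apply, Int.cast_sub] at e2
    have e4 : (p 0 * x 0 + p 1 * x 1) - (σ * c) * jb x
        - (((p 0 : ℝ) ^ 2 + (p 1 : ℝ) ^ 2) - c ^ 2) / 2
        = (f - c) * (σ * jb x) - (f - c) * (2 * f - (f - c)) / 2 := by
      have e5 : (f - σ * jb x) ^ 2 = f ^ 2 - 2 * f * (σ * jb x) + jb x ^ 2 := by
        have : (σ * jb x) ^ 2 = jb x ^ 2 := by rw [mul_pow, hσ2, one_mul]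
        rw [← this]; ring
      nlinarith
    have e6 : (f - c) * (σ * jb x) - (f - c) * (2 * f - (f - c)) / 2 =
        (f - c) * (σ * jb x - f + (f - c) / 2) := by ring
    rw [e4, e6, abs_mul]
    have e7 : |σ * jb x - f + (f - c) / 2| ≤ 10 * (N + znorm p) := by
      have := abs_le.1 hxc
      have := abs_le.1 hfb
      rcases hσ with rfl | rfl <;> rw [abs_le] <;> constructor <;> linarith
    calc |f - c| * |σ * jb x - f + (f - c) / 2| ≤ 1 * (10 * (N + znorm p)) := by gcongr
      _ = _ := one_mul _
  have hcount := card_near_level_set_le hN hP p rfl E hE key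
  refine hcount.trans ?_
  have hs1 : 1 / √(znorm p) ≤ 2 * (1 / √(jb p)) := by
    have hz : 0 < √(znorm p) := Real.sqrt_pos.2 (by linarith)
    have hj : 0 < √(jb p) := Real.sqrt_pos.2 (by linarith)
    have hle : √(jb p) ≤ 2 * √(znorm p) := by
      rw [Real.sqrt_le_left (by positivity), mul_pow, Real.sq_sqrt (by linarith)]
      linarith [jb_le_znorm_add_one p]
    rw [mul_one_div, div_le_div_iff₀ hz hj]
    linarith
  have hs2 : N * √N = N ^ 2 * (1 / √N) := by
    have hz : 0 < √N := Real.sqrt_pos.2 (by linarith)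
    have : √N ^ 2 = N := Real.sq_sqrt (by linarith)
    field_simp
    exact this
  have hs3 : 0 ≤ 1 / √N := by positivity
  rw [hs2, div_eq_mul_one_div, ← mul_add, mul_assoc, show (8040 : ℝ) = 4020 * 2 by norm_num,
    mul_assoc, mul_left_comm 2]
  gcongr
  linarith

theorem sum_range_one_add_rpow_le {γ : ℝ} (h1 : -1 < γ) (h0 : γ ≤ 0) (K : ℕ) :
    ∑ k ∈ Finset.range K, (1 + (k : ℝ)) ^ γ ≤ (K : ℝ) ^ (γ + 1) / (γ + 1) := by
  have hγ : 0 < γ + 1 := by linarith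
  induction K with
  | zero => simp [Real.zero_rpow hγ.ne']
  | succ K ih =>
    rw [Finset.sum_range_succ]
    push_cast
    have hx : (0 : ℝ) < 1 + K := by positivity
    have hb := rpow_one_add_le_one_add_mul_self (s := -1 / (1 + (K : ℝ))) (p := γ + 1)
      (by rw [le_div_iff₀ hx]; have : (0 : ℝ) ≤ K := by positivity
          linarith) hγ.le (by linarith)
    have e1 : 1 + -1 / (1 + (K : ℝ)) = K / (1 + K) := by field_simp; ring
    rw [e1, Real.div_rpow (by positivity) hx.le, div_le_iff₀ (by positivity)] at hb
    have e2 : (1 + (K : ℝ)) ^ (γ + 1) = (1 + (K : ℝ)) ^ γ * (1 + K) := by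
      rw [Real.rpow_add hx, Real.rpow_one]
    have e3 : (1 + (γ + 1) * (-1 / (1 + (K : ℝ)))) * (1 + (K : ℝ)) ^ (γ + 1) =
        (1 + (K : ℝ)) ^ (γ + 1) - (γ + 1) * (1 + (K : ℝ)) ^ γ := by
      rw [e2]; field_simp; ring
    rw [e3] at hb
    rw [le_div_iff₀ hγ] at ih ⊢
    rw [add_comm (K : ℝ) 1]
    linarith

theorem sum_one_add_abs_rpow_le {γ R : ℝ} (h1 : -1 < γ) (h0 : γ ≤ 0) (hR : 0 ≤ R)
    (S : Finset ℤ) (hS : ∀ t ∈ S, 1 + |(t : ℝ)| ≤ R) :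
    ∑ t ∈ S, (1 + |(t : ℝ)|) ^ γ ≤ 2 / (γ + 1) * R ^ (γ + 1) := by
  have hγ : 0 < γ + 1 := by linarith
  have habs (t : ℤ) : |(t : ℝ)| = (t.natAbs : ℝ) := by
    rw [Nat.cast_natAbs, Int.cast_abs]
  have hmaps : ∀ t ∈ S, t.natAbs ∈ Finset.range ⌊R⌋₊ := fun t ht => by
    have := hS t ht
    rw [habs] at this
    rw [Finset.mem_range, ← Nat.add_one_le_iff]
    apply Nat.le_floor
    push_cast
    linarith
  rw [← Finset.sum_fiberwise_of_maps_to hmaps]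
  calc ∑ k ∈ Finset.range ⌊R⌋₊, ∑ t ∈ S with t.natAbs = k, (1 + |(t : ℝ)|) ^ γ
      ≤ ∑ k ∈ Finset.range ⌊R⌋₊, 2 * (1 + (k : ℝ)) ^ γ := by
        refine Finset.sum_le_sum fun k _ => ?_
        have hc : (S.filter fun t : ℤ => t.natAbs = k).card ≤ 2 := by
          refine (Finset.card_le_card (t := {(k : ℤ), -(k : ℤ)}) fun t ht => ?_).trans
            Finset.card_le_two
          rw [Finset.mem_filter] at ht
          simp only [Finset.mem_insert, Finset.mem_singleton]
          omega
        calc ∑ t ∈ S with t.natAbs = k, (1 + |(t : ℝ)|) ^ γ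
            = ∑ t ∈ S with t.natAbs = k, (1 + (k : ℝ)) ^ γ := by
              refine Finset.sum_congr rfl fun t ht => ?_
              rw [habs, (Finset.mem_filter.1 ht).2]
          _ = ((S.filter fun t : ℤ => t.natAbs = k).card : ℝ) * (1 + (k : ℝ)) ^ γ := by simp
          _ ≤ _ := by
              gcongr
              exact_mod_cast hc
    _ = 2 * ∑ k ∈ Finset.range ⌊R⌋₊, (1 + (k : ℝ)) ^ γ := by rw [Finset.mul_sum]
    _ ≤ 2 * ((⌊R⌋₊ : ℝ) ^ (γ + 1) / (γ + 1)) := by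
        gcongr; exact sum_range_one_add_rpow_le h1 h0 _
    _ ≤ 2 * (R ^ (γ + 1) / (γ + 1)) := by
        gcongr; exact Nat.floor_le hR
    _ = _ := by ring

/-- Power sums of the Japanese bracket over a ball. -/
theorem exists_sum_jb_rpow_le {β : ℝ} (hβ : -2 < β) :
    ∃ C : ℝ, 0 < C ∧ ∀ (R : ℝ), 1 ≤ R → ∀ B : Finset (Fin 2 → ℤ), (∀ x ∈ B, jb x ≤ R) →
      ∑ x ∈ B, jb x ^ β ≤ C * R ^ (β + 2) := by
  rcases le_total 0 β with h0 | h0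
  · refine ⟨25, by norm_num, fun R hR B hB => ?_⟩
    calc ∑ x ∈ B, jb x ^ β ≤ ∑ x ∈ B, R ^ β :=
          Finset.sum_le_sum fun x hx =>
            Real.rpow_le_rpow (by linarith [one_le_jb x]) (hB x hx) h0
      _ = (B.card : ℝ) * R ^ β := by simp
      _ ≤ 25 * R ^ 2 * R ^ β := by
          gcongr
          exact card_le_of_znorm_le hR B fun x hx => by
            linarith [znorm_le_jb x, hB x hx]
      _ = 25 * R ^ (β + 2) := by
          rw [Real.rpow_add (by linarith), Real.rpow_two]; ring
  · have hγ : 0 < β / 2 + 1 := by linarith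
    refine ⟨(1 / 2 : ℝ) ^ β * (2 / (β / 2 + 1)) ^ 2 * 2 ^ (β + 2), by positivity,
      fun R hR B hB => ?_⟩
    have hpt (x : Fin 2 → ℤ) : jb x ^ β ≤
        (1 / 2 : ℝ) ^ β * ((1 + |(x 0 : ℝ)|) ^ (β / 2) * (1 + |(x 1 : ℝ)|) ^ (β / 2)) := by
      have ha := abs_nonneg (x 0 : ℝ)
      have hb := abs_nonneg (x 1 : ℝ)
      rw [← Real.mul_rpow (by positivity) (by positivity)]
      have e1 : ((1 + |(x 0 : ℝ)|) * (1 + |(x 1 : ℝ)|)) ^ (β / 2) =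
          √((1 + |(x 0 : ℝ)|) * (1 + |(x 1 : ℝ)|)) ^ β := by
        rw [Real.sqrt_eq_rpow, ← Real.rpow_mul (by positivity)]
        congr 1; ring
      rw [e1, ← Real.mul_rpow (by positivity) (by positivity)]
      refine Real.rpow_le_rpow_of_nonpos (by positivity) ?_ h0
      have h2 : √((1 + |(x 0 : ℝ)|) * (1 + |(x 1 : ℝ)|)) ≤ 2 * jb x := by
        have := one_le_jb x
        rw [Real.sqrt_le_left (by linarith), mul_pow, jb_sq,
          znorm_sq_eq (i := 0) (j := 1) (by decide), ← sq_abs (x 0 : ℝ), ← sq_abs (x 1 : ℝ)]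
        nlinarith [sq_nonneg (|(x 0 : ℝ)| - 1), sq_nonneg (|(x 1 : ℝ)| - 1),
          sq_nonneg (|(x 0 : ℝ)| - |(x 1 : ℝ)|)]
      linarith
    have hcoord (i : Fin 2) : ∀ t ∈ B.image (fun x : Fin 2 → ℤ => x i), 1 + |(t : ℝ)| ≤ 2 * R := by
      intro t ht
      obtain ⟨x, hx, rfl⟩ := Finset.mem_image.1 ht
      linarith [abs_coord_le_znorm x i, znorm_le_jb x, hB x hx]
    have h1d (i : Fin 2) := sum_one_add_abs_rpow_le (γ := β / 2) (by linarith) (by linarith)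
      (by linarith : 0 ≤ 2 * R) _ (hcoord i)
    have hinj : Set.InjOn (fun x : Fin 2 → ℤ => (x 0, x 1)) B := by
      intro x _ y _ hxy
      simp only [Prod.mk.injEq] at hxy
      funext l
      fin_cases l
      exacts [hxy.1, hxy.2]
    have hsub : B.image (fun x : Fin 2 → ℤ => (x 0, x 1)) ⊆
        B.image (fun x : Fin 2 → ℤ => x 0) ×ˢ B.image (fun x : Fin 2 → ℤ => x 1) := by
      intro y hy
      obtain ⟨x, hx, rfl⟩ := Finset.mem_image.1 hy
      exact Finset.mk_mem_product (Finset.mem_image_of_mem _ hx) (Finset.mem_image_of_mem _ hx)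
    calc ∑ x ∈ B, jb x ^ β ≤ ∑ x ∈ B, (1 / 2 : ℝ) ^ β *
          ((1 + |(x 0 : ℝ)|) ^ (β / 2) * (1 + |(x 1 : ℝ)|) ^ (β / 2)) :=
          Finset.sum_le_sum fun x _ => hpt x
      _ = (1 / 2 : ℝ) ^ β * ∑ y ∈ B.image (fun x : Fin 2 → ℤ => (x 0, x 1)),
          ((1 + |(y.1 : ℝ)|) ^ (β / 2) * (1 + |(y.2 : ℝ)|) ^ (β / 2)) := by
          rw [Finset.sum_image hinj, Finset.mul_sum]
      _ ≤ (1 / 2 : ℝ) ^ β * ∑ y ∈ B.image (fun x : Fin 2 → ℤ => x 0) ×ˢ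
            B.image (fun x : Fin 2 → ℤ => x 1),
          ((1 + |(y.1 : ℝ)|) ^ (β / 2) * (1 + |(y.2 : ℝ)|) ^ (β / 2)) := by
          gcongr
      _ = (1 / 2 : ℝ) ^ β * ((∑ t ∈ B.image (fun x : Fin 2 → ℤ => x 0), (1 + |(t : ℝ)|) ^ (β / 2)) *
          ∑ t ∈ B.image (fun x : Fin 2 → ℤ => x 1), (1 + |(t : ℝ)|) ^ (β / 2)) := by
          rw [Finset.sum_product, Finset.sum_mul_sum]
      _ ≤ (1 / 2 : ℝ) ^ β * ((2 / (β / 2 + 1) * (2 * R) ^ (β / 2 + 1)) *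
          (2 / (β / 2 + 1) * (2 * R) ^ (β / 2 + 1))) := by
          gcongr
          exacts [h1d 0, h1d 1]
      _ = (1 / 2 : ℝ) ^ β * (2 / (β / 2 + 1)) ^ 2 * (2 * R) ^ (β + 2) := by
          have : (2 * R) ^ (β + 2) = (2 * R) ^ (β / 2 + 1) * (2 * R) ^ (β / 2 + 1) := by
            rw [← Real.rpow_add (by linarith)]; congr 1; ring
          rw [this]; ring
      _ = _ := by rw [Real.mul_rpow (by norm_num) (by linarith)]; ring

theorem exists_sum_shifted_jb_rpow_le :
    ∃ C : ℝ, 0 < C ∧ ∀ (N : ℝ), 1 ≤ N → ∀ (n : Fin 2 → ℤ) (B : Finset (Fin 2 → ℤ)),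
      (∀ x ∈ B, znorm x ≤ 2 * N) →
      ∑ x ∈ B, jb (n - x) ^ (-1 / 2 : ℝ) ≤ C * (N ^ 2 * N ^ (-1 / 2 : ℝ)) := by
  obtain ⟨C, hC, h⟩ := exists_sum_jb_rpow_le (β := -1 / 2) (by norm_num)
  refine ⟨C + 25, by positivity, fun N hN n B hB => ?_⟩
  rw [← Finset.sum_filter_add_sum_filter_not B fun x => jb (n - x) ≤ N]
  have h1 : ∑ x ∈ B with jb (n - x) ≤ N, jb (n - x) ^ (-1 / 2 : ℝ) ≤
      C * (N ^ 2 * N ^ (-1 / 2 : ℝ)) := by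
    have e := Finset.sum_image (s := B.filter fun x => jb (n - x) ≤ N)
      (f := fun y => jb y ^ (-1 / 2 : ℝ)) (g := fun x => n - x)
      (fun x _ y _ hxy => by simpa using hxy)
    rw [← e]
    refine (h N hN _ fun x hx => ?_).trans (le_of_eq ?_)
    · obtain ⟨y, hy, rfl⟩ := Finset.mem_image.1 hx
      exact (Finset.mem_filter.1 hy).2
    · rw [Real.rpow_add (by linarith), Real.rpow_two, mul_comm (N ^ 2)]
  have h2 : ∑ x ∈ B with ¬ jb (n - x) ≤ N, jb (n - x) ^ (-1 / 2 : ℝ) ≤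
      25 * (N ^ 2 * N ^ (-1 / 2 : ℝ)) := by
    calc ∑ x ∈ B with ¬ jb (n - x) ≤ N, jb (n - x) ^ (-1 / 2 : ℝ)
        ≤ ∑ x ∈ B with ¬ jb (n - x) ≤ N, N ^ (-1 / 2 : ℝ) :=
          Finset.sum_le_sum fun x hx => Real.rpow_le_rpow_of_nonpos (by linarith)
            (not_le.1 (Finset.mem_filter.1 hx).2).le (by norm_num)
      _ = ((B.filter fun x => ¬ jb (n - x) ≤ N).card : ℝ) * N ^ (-1 / 2 : ℝ) := by simp
      _ ≤ 25 * N ^ 2 * N ^ (-1 / 2 : ℝ) := by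
          gcongr
          exact card_le_of_znorm_le hN _ fun x hx => hB x (Finset.mem_filter.1 hx).1
      _ = _ := by ring
  linarith

/-- The cubic sum for ordered frequencies `N₃ ≤ N₂ ≤ N₁`, with `a, b, c` the corresponding
indices. -/
theorem exists_ordered_cubic_sum_le {α s : ℝ} (hα0 : 0 < α) (hα1 : α < 5 / 12) (hs : 0 < s) :
    ∃ C : ℝ, 0 < C ∧ ∀ (a b c : Fin 3), (∀ l, l = a ∨ l = b ∨ l = c) →
      ∀ N₁ N₂ N₃ : ℝ, 1 ≤ N₃ → N₃ ≤ N₂ → N₂ ≤ N₁ →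
      ∀ σ σ₁ σ₂ σ₃ m : ℝ, (σ₁ = -1 ∨ σ₁ = 1) → (σ₂ = -1 ∨ σ₂ = 1) →
      ∀ T : Finset (Fin 3 → Fin 2 → ℤ),
      (∀ v ∈ T, ann N₁ (v a) ∧ ann N₂ (v b) ∧ ann N₃ (v c) ∧
        |σ * jb (v a + v b + v c) + σ₁ * jb (v a) + σ₂ * jb (v b) + σ₃ * jb (v c) - m| ≤ 1) →
      ∑ v ∈ T, jb (v a + v b + v c) ^ (2 * (s - 1)) *
        (jb (v a) ^ (-2 + 2 * α) * jb (v b) ^ (-2 + 2 * α) * jb (v c) ^ (-2 + 2 * α)) ≤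
      C * N₁ ^ (2 * (s - sAlpha α)) := by
  obtain ⟨C₁, hC₁, hsum⟩ := exists_sum_jb_rpow_le (β := 2 * (s - 1)) (by linarith)
  obtain ⟨C₂, hC₂, hshift⟩ := exists_sum_shifted_jb_rpow_le
  refine ⟨((1 / 2 : ℝ) ^ (-2 + 2 * α)) ^ 3 * (8040 * (C₂ + 25)) * (C₁ * 7 ^ (2 * s)),
    by positivity, ?_⟩
  intro a b c habc N₁ N₂ N₃ h3 h32 h21 σ σ₁ σ₂ σ₃ m hσ₁ hσ₂ T hT
  have hN2 : 1 ≤ N₂ := h3.trans h32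
  have hN1 : 1 ≤ N₁ := hN2.trans h21
  have hann {N : ℝ} (hN : 1 ≤ N) {x : Fin 2 → ℤ} (hx : ann N x) :
      jb x ^ (-2 + 2 * α) ≤ (1 / 2 : ℝ) ^ (-2 + 2 * α) * N ^ (-2 + 2 * α) := by
    rw [← Real.mul_rpow (by norm_num) (by linarith)]
    refine Real.rpow_le_rpow_of_nonpos (by linarith) ?_ (by linarith)
    linarith [hx.1, znorm_le_jb x]
  set W := ((1 / 2 : ℝ) ^ (-2 + 2 * α)) ^ 3 *
    (N₁ ^ (-2 + 2 * α) * N₂ ^ (-2 + 2 * α) * N₃ ^ (-2 + 2 * α)) with hW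
  have hW0 : 0 ≤ W := by positivity
  have hjb0 (x : Fin 2 → ℤ) : 0 ≤ jb x := by linarith [one_le_jb x]
  have hpow0 (x : Fin 2 → ℤ) (β : ℝ) : 0 ≤ jb x ^ β := Real.rpow_nonneg (hjb0 x) _
  set B := T.image (fun v => v a + v b + v c)
  set D := T.image (fun v => v c)
  have hDz : ∀ z ∈ D, znorm z ≤ 2 * N₃ := by
    intro z hz
    obtain ⟨v, hv, rfl⟩ := Finset.mem_image.1 hz
    exact (hT v hv).2.2.1.2
  have hBz : ∀ n ∈ B, jb n ≤ 7 * N₁ := by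
    intro n hn
    obtain ⟨v, hv, rfl⟩ := Finset.mem_image.1 hn
    obtain ⟨k1, k2, k3, -⟩ := hT v hv
    linarith [jb_le_znorm_add_one (v a + v b + v c), znorm_add_le (v a + v b) (v c),
      znorm_add_le (v a) (v b), k1.2, k2.2, k3.2]
  have hfib : ∀ y ∈ B ×ˢ D,
      ((T.filter fun v => (v a + v b + v c, v c) = y).card : ℝ) ≤
        8040 * N₂ ^ 2 * (jb (y.1 - y.2) ^ (-1 / 2 : ℝ) + N₂ ^ (-1 / 2 : ℝ)) := by
    rintro ⟨n, z⟩ -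
    have hinj : Set.InjOn (fun v : Fin 3 → Fin 2 → ℤ => v b)
        (T.filter fun v => (v a + v b + v c, v c) = (n, z)) := by
      intro v hv w hw hvw
      simp only [Finset.coe_filter, Set.mem_ofPred_eq, Prod.mk.injEq] at hv hw hvw
      have hc : v c = w c := hv.2.2.trans hw.2.2.symm
      have ha : v a = w a := by
        have := hv.2.1.trans hw.2.1.symm
        rw [hvw, hc] at this
        simpa using this
      funext l
      rcases habc l with rfl | rfl | rfl <;> assumption
    rw [← Finset.card_image_of_injOn hinj]
    refine card_two_wave_le (σ := σ₂) (τ := σ₁) (c := m - σ * jb n - σ₃ * jb z) hN2 hσ₂ hσ₁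
      (n - z) _ ?_ ?_
    all_goals
      intro x hx
      obtain ⟨v, hv, rfl⟩ := Finset.mem_image.1 hx
      simp only [Finset.mem_filter, Prod.mk.injEq] at hv
      obtain ⟨hvT, rfl, rfl⟩ := hv
      obtain ⟨k1, k2, k3, k4⟩ := hT v hvT
    · exact k2
    · refine le_trans (le_of_eq ?_) k4
      rw [show v a + v b + v c - v c - v b = v a by abel]
      congr 1; ring
  have hinner : ∀ n ∈ B, ∑ z ∈ D, (jb (n - z) ^ (-1 / 2 : ℝ) + N₂ ^ (-1 / 2 : ℝ)) ≤
      (C₂ + 25) * (N₃ ^ 2 * N₃ ^ (-1 / 2 : ℝ)) := by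
    intro n _
    rw [Finset.sum_add_distrib]
    have e1 := hshift N₃ h3 n D hDz
    have e2 : ∑ z ∈ D, N₂ ^ (-1 / 2 : ℝ) ≤ 25 * N₃ ^ 2 * N₃ ^ (-1 / 2 : ℝ) := by
      rw [Finset.sum_const, nsmul_eq_mul]
      have := card_le_of_znorm_le h3 D hDz
      have h' := Real.rpow_le_rpow_of_nonpos (z := (-1 / 2 : ℝ)) (by linarith) h32 (by norm_num)
      gcongr
    linarith
  have hmaps : ∀ v ∈ T, (v a + v b + v c, v c) ∈ B ×ˢ D := fun v hv =>
    Finset.mk_mem_product (Finset.mem_image_of_mem _ hv) (Finset.mem_image_of_mem _ hv)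
  have hpowers : N₁ ^ (-2 + 2 * α) * N₂ ^ (-2 + 2 * α) * N₃ ^ (-2 + 2 * α) *
      (N₂ ^ 2 * (N₃ ^ 2 * N₃ ^ (-1 / 2 : ℝ))) * N₁ ^ (2 * s) ≤
      N₁ ^ (2 * (s - sAlpha α)) := by
    have p1 : 0 < N₁ := by linarith
    have p2 : 0 < N₂ := by linarith
    have p3 : 0 < N₃ := by linarith
    have e2 : N₂ ^ (-2 + 2 * α) * N₂ ^ 2 = N₂ ^ (2 * α) := by
      rw [← Real.rpow_two, ← Real.rpow_add p2]; congr 1; ring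
    have e3 : N₃ ^ (-2 + 2 * α) * (N₃ ^ 2 * N₃ ^ (-1 / 2 : ℝ)) = N₃ ^ (2 * α - 1 / 2) := by
      rw [← Real.rpow_two, ← Real.rpow_add p3, ← Real.rpow_add p3]; congr 1; ring
    have e4 : N₁ ^ (-2 + 2 * α) * N₂ ^ (-2 + 2 * α) * N₃ ^ (-2 + 2 * α) *
        (N₂ ^ 2 * (N₃ ^ 2 * N₃ ^ (-1 / 2 : ℝ))) * N₁ ^ (2 * s) =
        N₁ ^ (-2 + 2 * α) * N₂ ^ (2 * α) * N₃ ^ (2 * α - 1 / 2) * N₁ ^ (2 * s) := by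
      rw [← e2, ← e3]; ring
    have e5 : N₂ ^ (2 * α) ≤ N₁ ^ (2 * α) := Real.rpow_le_rpow p2.le h21 (by linarith)
    rw [e4]
    by_cases hα : α < 1 / 4
    · have e6 : N₃ ^ (2 * α - 1 / 2) ≤ 1 := Real.rpow_le_one_of_one_le_of_nonpos h3 (by linarith)
      calc N₁ ^ (-2 + 2 * α) * N₂ ^ (2 * α) * N₃ ^ (2 * α - 1 / 2) * N₁ ^ (2 * s)
          ≤ N₁ ^ (-2 + 2 * α) * N₁ ^ (2 * α) * 1 * N₁ ^ (2 * s) := by gcongr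
        _ = N₁ ^ (2 * (s - sAlpha α)) := by
            rw [mul_one, ← Real.rpow_add p1, ← Real.rpow_add p1, sAlpha, if_pos hα]
            congr 1; ring
    · have e6 : N₃ ^ (2 * α - 1 / 2) ≤ N₁ ^ (2 * α - 1 / 2) :=
        Real.rpow_le_rpow p3.le (h32.trans h21) (by linarith)
      calc N₁ ^ (-2 + 2 * α) * N₂ ^ (2 * α) * N₃ ^ (2 * α - 1 / 2) * N₁ ^ (2 * s)
          ≤ N₁ ^ (-2 + 2 * α) * N₁ ^ (2 * α) * N₁ ^ (2 * α - 1 / 2) * N₁ ^ (2 * s) := by gcongr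
        _ = N₁ ^ (2 * (s - sAlpha α)) := by
            rw [← Real.rpow_add p1, ← Real.rpow_add p1, ← Real.rpow_add p1, sAlpha, if_neg hα]
            congr 1; ring
  calc ∑ v ∈ T, jb (v a + v b + v c) ^ (2 * (s - 1)) *
        (jb (v a) ^ (-2 + 2 * α) * jb (v b) ^ (-2 + 2 * α) * jb (v c) ^ (-2 + 2 * α))
      ≤ ∑ v ∈ T, jb (v a + v b + v c) ^ (2 * (s - 1)) * W := by
        refine Finset.sum_le_sum fun v hv => ?_
        obtain ⟨k1, k2, k3, -⟩ := hT v hv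
        refine mul_le_mul_of_nonneg_left ?_ (hpow0 _ _)
        calc _ ≤ ((1 / 2 : ℝ) ^ (-2 + 2 * α) * N₁ ^ (-2 + 2 * α)) *
              ((1 / 2 : ℝ) ^ (-2 + 2 * α) * N₂ ^ (-2 + 2 * α)) *
              ((1 / 2 : ℝ) ^ (-2 + 2 * α) * N₃ ^ (-2 + 2 * α)) := by
              refine mul_le_mul (mul_le_mul (hann hN1 k1) (hann hN2 k2) (hpow0 _ _) ?_)
                (hann h3 k3) (hpow0 _ _) ?_ <;> positivity
          _ = W := by rw [hW]; ring
    _ = ∑ y ∈ B ×ˢ D, ∑ v ∈ T with (v a + v b + v c, v c) = y,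
          jb (v a + v b + v c) ^ (2 * (s - 1)) * W :=
        (Finset.sum_fiberwise_of_maps_to hmaps _).symm
    _ ≤ ∑ y ∈ B ×ˢ D, 8040 * N₂ ^ 2 * (jb (y.1 - y.2) ^ (-1 / 2 : ℝ) + N₂ ^ (-1 / 2 : ℝ)) *
          (jb y.1 ^ (2 * (s - 1)) * W) := by
        refine Finset.sum_le_sum fun y hy => ?_
        calc ∑ v ∈ T with (v a + v b + v c, v c) = y, jb (v a + v b + v c) ^ (2 * (s - 1)) * W
            = ∑ v ∈ T with (v a + v b + v c, v c) = y, jb y.1 ^ (2 * (s - 1)) * W := by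
              refine Finset.sum_congr rfl fun v hv => ?_
              rw [← (Finset.mem_filter.1 hv).2]
          _ = ((T.filter fun v => (v a + v b + v c, v c) = y).card : ℝ) *
                (jb y.1 ^ (2 * (s - 1)) * W) := by rw [Finset.sum_const, nsmul_eq_mul]
          _ ≤ _ := mul_le_mul_of_nonneg_right (hfib y hy) (mul_nonneg (hpow0 _ _) hW0)
    _ = ∑ n ∈ B, 8040 * N₂ ^ 2 * W * jb n ^ (2 * (s - 1)) *
          ∑ z ∈ D, (jb (n - z) ^ (-1 / 2 : ℝ) + N₂ ^ (-1 / 2 : ℝ)) := by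
        rw [Finset.sum_product]
        refine Finset.sum_congr rfl fun n _ => ?_
        rw [Finset.mul_sum]
        exact Finset.sum_congr rfl fun z _ => by ring
    _ ≤ ∑ n ∈ B, 8040 * N₂ ^ 2 * W * jb n ^ (2 * (s - 1)) *
          ((C₂ + 25) * (N₃ ^ 2 * N₃ ^ (-1 / 2 : ℝ))) :=
        Finset.sum_le_sum fun n hn => mul_le_mul_of_nonneg_left (hinner n hn)
          (mul_nonneg (by positivity) (hpow0 _ _))
    _ = 8040 * N₂ ^ 2 * W * ((C₂ + 25) * (N₃ ^ 2 * N₃ ^ (-1 / 2 : ℝ))) *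
          ∑ n ∈ B, jb n ^ (2 * (s - 1)) := by
        rw [Finset.mul_sum]
        exact Finset.sum_congr rfl fun n _ => by ring
    _ ≤ 8040 * N₂ ^ 2 * W * ((C₂ + 25) * (N₃ ^ 2 * N₃ ^ (-1 / 2 : ℝ))) *
          (C₁ * (7 ^ (2 * s) * N₁ ^ (2 * s))) := by
        refine mul_le_mul_of_nonneg_left ?_ (by positivity)
        refine (hsum (7 * N₁) (by linarith) B hBz).trans (le_of_eq ?_)
        rw [← Real.mul_rpow (by norm_num) (by linarith)]
        congr 2; ring
    _ = ((1 / 2 : ℝ) ^ (-2 + 2 * α)) ^ 3 * (8040 * (C₂ + 25)) * (C₁ * 7 ^ (2 * s)) *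
          (N₁ ^ (-2 + 2 * α) * N₂ ^ (-2 + 2 * α) * N₃ ^ (-2 + 2 * α) *
            (N₂ ^ 2 * (N₃ ^ 2 * N₃ ^ (-1 / 2 : ℝ))) * N₁ ^ (2 * s)) := by
        rw [hW]; ring
    _ ≤ _ := mul_le_mul_of_nonneg_left hpowers (by positivity)

/-- cubic sum estimate: for `0 < α < 5/12` and `s > 0` there is `C > 0`
(depending only on `s, α`) such that for all signs, dyadic `N₁, N₂, N₃` and all `m ∈ ℤ`,
`∑_{n₁,n₂,n₃} ⟨n₁+n₂+n₃⟩^{2(s−1)} ∏_j 1_{|n_j|∼N_j} ⟨n_j⟩^{−2+2α} 1_{|φ−m|≤1}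
  ≤ C max(N₁,N₂,N₃)^{2(s−s_α)}`. -/
theorem cubic_sum_estimate (α s : ℝ) (hα0 : 0 < α) (hα1 : α < 5 / 12) (hs : 0 < s) :
    ∃ C : ℝ, 0 < C ∧
      ∀ (σ σ₁ σ₂ σ₃ : ℝ), (σ = -1 ∨ σ = 1) → (σ₁ = -1 ∨ σ₁ = 1) →
        (σ₂ = -1 ∨ σ₂ = 1) → (σ₃ = -1 ∨ σ₃ = 1) →
        ∀ (k₁ k₂ k₃ : ℕ) (m : ℤ),
          (∑' v : Fin 3 → Fin 2 → ℤ,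
            Set.indicator
              {v : Fin 3 → Fin 2 → ℤ |
                ann ((2:ℝ)^k₁) (v 0) ∧ ann ((2:ℝ)^k₂) (v 1) ∧ ann ((2:ℝ)^k₃) (v 2) ∧
                |phase σ σ₁ σ₂ σ₃ (v 0) (v 1) (v 2) - (m : ℝ)| ≤ 1}
              (fun v => jb (v 0 + v 1 + v 2) ^ (2 * (s - 1)) *
                (jb (v 0) ^ (-2 + 2 * α) * jb (v 1) ^ (-2 + 2 * α) *
                  jb (v 2) ^ (-2 + 2 * α))) v) ≤
            C * (max ((2:ℝ)^k₁) (max ((2:ℝ)^k₂) ((2:ℝ)^k₃))) ^ (2 * (s - sAlpha α)) := by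
  obtain ⟨C, hC, h⟩ := exists_ordered_cubic_sum_le hα0 hα1 hs
  refine ⟨C, hC, fun σ σ₁ σ₂ σ₃ _ h₁ h₂ h₃ k₁ k₂ k₃ m => ?_⟩
  have one_le (k : ℕ) : (1 : ℝ) ≤ 2 ^ k := one_le_pow₀ (by norm_num)
  have o₁ := one_le k₁
  have o₂ := one_le k₂
  have o₃ := one_le k₃
  generalize (2 : ℝ) ^ k₁ = N₁ at *
  generalize (2 : ℝ) ^ k₂ = N₂ at *
  generalize (2 : ℝ) ^ k₃ = N₃ at *
  classical
  refine tsum_le_of_sum_le' (by positivity) fun T => ?_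
  rw [Finset.sum_indicator_eq_sum_filter]
  suffices hU : ∀ U : Finset (Fin 3 → Fin 2 → ℤ),
      (∀ v ∈ U, ann N₁ (v 0) ∧ ann N₂ (v 1) ∧ ann N₃ (v 2) ∧
        |phase σ σ₁ σ₂ σ₃ (v 0) (v 1) (v 2) - (m : ℝ)| ≤ 1) →
      ∑ v ∈ U, jb (v 0 + v 1 + v 2) ^ (2 * (s - 1)) *
        (jb (v 0) ^ (-2 + 2 * α) * jb (v 1) ^ (-2 + 2 * α) * jb (v 2) ^ (-2 + 2 * α)) ≤
      C * max N₁ (max N₂ N₃) ^ (2 * (s - sAlpha α)) from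
    hU _ fun v hv => (Finset.mem_filter.1 hv).2
  intro U hU
  have key (a b c : Fin 3) (hcb : ![N₁, N₂, N₃] c ≤ ![N₁, N₂, N₃] b)
      (hba : ![N₁, N₂, N₃] b ≤ ![N₁, N₂, N₃] a) (habc : ∀ l, l = a ∨ l = b ∨ l = c)
      (hadd : ∀ v : Fin 3 → Fin 2 → ℤ, v a + v b + v c = v 0 + v 1 + v 2)
      (hsum : ∀ f : Fin 3 → ℝ, f a + f b + f c = f 0 + f 1 + f 2)
      (hprod : ∀ f : Fin 3 → ℝ, f a * f b * f c = f 0 * f 1 * f 2) :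
      ∑ v ∈ U,
        jb (v 0 + v 1 + v 2) ^ (2 * (s - 1)) *
          (jb (v 0) ^ (-2 + 2 * α) * jb (v 1) ^ (-2 + 2 * α) * jb (v 2) ^ (-2 + 2 * α)) ≤
      C * max N₁ (max N₂ N₃) ^ (2 * (s - sAlpha α)) := by
    have hsign : ∀ l, ![σ₁, σ₂, σ₃] l = -1 ∨ ![σ₁, σ₂, σ₃] l = 1 := by
      simpa [Fin.forall_fin_succ] using ⟨h₁, h₂, h₃⟩
    have hone : ∀ l, 1 ≤ ![N₁, N₂, N₃] l := by
      simpa [Fin.forall_fin_succ] using ⟨o₁, o₂, o₃⟩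
    have hle : ∀ l, ![N₁, N₂, N₃] l ≤ ![N₁, N₂, N₃] a := by
      intro l
      rcases habc l with rfl | rfl | rfl
      exacts [le_rfl, hba, hcb.trans hba]
    have hge : ∀ l, ![N₁, N₂, N₃] l ≤ max N₁ (max N₂ N₃) := by
      simp [Fin.forall_fin_succ]
    have hmax : max N₁ (max N₂ N₃) = ![N₁, N₂, N₃] a :=
      le_antisymm (max_le (hle 0) (max_le (hle 1) (hle 2))) (hge a)
    rw [hmax]
    refine le_trans (le_of_eq ?_) (h a b c habc _ _ _ (hone c) hcb hba σ _ _ (![σ₁, σ₂, σ₃] c) m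
      (hsign a) (hsign b) U fun v hv => ?_)
    · refine Finset.sum_congr rfl fun v _ => ?_
      rw [hadd, hprod fun l => jb (v l) ^ (-2 + 2 * α)]
    · obtain ⟨e₁, e₂, e₃, e⟩ := hU v hv
      have hann : ∀ l, ann (![N₁, N₂, N₃] l) (v l) := by
        simpa [Fin.forall_fin_succ] using ⟨e₁, e₂, e₃⟩
      refine ⟨hann a, hann b, hann c, le_trans (le_of_eq ?_) e⟩
      have := hsum fun l => ![σ₁, σ₂, σ₃] l * jb (v l)
      rw [hadd, phase]
      congr 1
      simp at this ⊢
      linarith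
  rcases le_total N₂ N₁ with h21 | h12
  · rcases le_total N₃ N₂ with h32 | h23
    · exact key 0 1 2 h32 h21 (by decide) (fun _ => by abel) (fun _ => by ring) fun _ => by ring
    · rcases le_total N₃ N₁ with h31 | h13
      · exact key 0 2 1 h23 h31 (by decide) (fun _ => by abel) (fun _ => by ring) fun _ => by ring
      · exact key 2 0 1 h21 h13 (by decide) (fun _ => by abel) (fun _ => by ring) fun _ => by ring
  · rcases le_total N₃ N₁ with h31 | h13
    · exact key 1 0 2 h31 h12 (by decide) (fun _ => by abel) (fun _ => by ring) fun _ => by ring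
    · rcases le_total N₃ N₂ with h32 | h23
      · exact key 1 2 0 h13 h32 (by decide) (fun _ => by abel) (fun _ => by ring) fun _ => by ring
      · exact key 2 1 0 h12 h23 (by decide) (fun _ => by abel) (fun _ => by ring) fun _ => by ring
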